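/- arXiv:1406.1958 — 5 statements merged into one kernel-verified Lean document; each statement's English description precedes it below -/
import Mathlib

section
/- For all λ, μ ∈ ℂ, the transfer matrices commute: τ_N(λ) τ_N(μ) = τ_N(μ) τ_N(λ) as operators on 𝔥_N. -/
open Complex Matrix Filter Topology

noncomputable section

/-- The index set of the standard basis of `𝔥_N = (ℂ²)^{⊗N}`. -/
abbrev St (N : ℕ) := Fin N → Fin 2

/-- The Pauli matrices `σ¹, σ², σ³`. -/
def pauli : Fin 3 → Matrix (Fin 2) (Fin 2) ℂ
  | 0 => !![0, 1; 1, 0]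
  | 1 => !![0, -Complex.I; Complex.I, 0]
  | 2 => !![1, 0; 0, -1]

/-- The operator `σₖᵃ` on `𝔥_N`, acting as `σᵃ` on the `k`-th tensor factor
and as the identity on the others. -/
def siteOp (N : ℕ) (a : Fin 3) (k : Fin N) : Matrix (St N) (St N) ℂ :=
  Matrix.of fun x y =>
    pauli a (x k) (y k) * ∏ j ∈ Finset.univ.erase k, (if x j = y j then (1 : ℂ) else 0)

/-- The L-operator `Lₖ(λ) = λ (I ⊗ 𝟙) + (i/2) Σₐ σᵃ ⊗ σₖᵃ` on `ℂ² ⊗ 𝔥_N`. -/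
def Lop (N : ℕ) (lam : ℂ) (k : Fin N) : Matrix (Fin 2 × St N) (Fin 2 × St N) ℂ :=
  lam • (1 : Matrix (Fin 2 × St N) (Fin 2 × St N) ℂ) +
    (Complex.I / 2) • ∑ a : Fin 3,
      Matrix.of fun p q : Fin 2 × St N => pauli a p.1 q.1 * siteOp N a k p.2 q.2

/-- The monodromy matrix `T_N(λ) = L_N(λ) L_{N-1}(λ) ⋯ L_1(λ)`. -/
def monodromy (N : ℕ) (lam : ℂ) : Matrix (Fin 2 × St N) (Fin 2 × St N) ℂ :=
  (((List.finRange N).reverse).map (Lop N lam)).prod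

/-- `A_N(λ)`: the (0,0) block of `T_N(λ)` in the auxiliary space. -/
def Aop (N : ℕ) (lam : ℂ) : Matrix (St N) (St N) ℂ :=
  Matrix.of fun x y => monodromy N lam (0, x) (0, y)

/-- `B_N(λ)`: the (0,1) block of `T_N(λ)` in the auxiliary space. -/
def Bop (N : ℕ) (lam : ℂ) : Matrix (St N) (St N) ℂ :=
  Matrix.of fun x y => monodromy N lam (0, x) (1, y)

/-- `C_N(λ)`: the (1,0) block of `T_N(λ)` in the auxiliary space. -/
def Cop (N : ℕ) (lam : ℂ) : Matrix (St N) (St N) ℂ :=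
  Matrix.of fun x y => monodromy N lam (1, x) (0, y)

/-- `D_N(λ)`: the (1,1) block of `T_N(λ)` in the auxiliary space. -/
def Dop (N : ℕ) (lam : ℂ) : Matrix (St N) (St N) ℂ :=
  Matrix.of fun x y => monodromy N lam (1, x) (1, y)

/-- The transfer matrix `τ_N(λ) = A_N(λ) + D_N(λ)`. -/
def tau (N : ℕ) (lam : ℂ) : Matrix (St N) (St N) ℂ := Aop N lam + Dop N lam

/-- The vacuum vector `|0⟩_N = v₊^{⊗N}`. -/
def vac (N : ℕ) : St N → ℂ := fun x => if x = (fun _ => (0 : Fin 2)) then 1 else 0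

/-- Cyclic successor on `Fin N`, implementing periodic boundary conditions. -/
def cyc {N : ℕ} (k : Fin N) : Fin N := ⟨(k.1 + 1) % N, Nat.mod_lt _ k.pos⟩

/-- The XXX Hamiltonian
`ℋ_N = (J/4) Σₖ (σₖ¹σ_{k+1}¹ + σₖ²σ_{k+1}² + σₖ³σ_{k+1}³ − 𝟙)`. -/
def Ham (N : ℕ) (J : ℝ) : Matrix (St N) (St N) ℂ :=
  ((J : ℂ) / 4) • ∑ k : Fin N,
    ((∑ a : Fin 3, siteOp N a k * siteOp N a (cyc k)) - 1)

/-- The product of creation operators `B_N(λ₁) ⋯ B_N(λ_ℓ)`. -/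
def betheProd (N : ℕ) {l : ℕ} (lam : Fin l → ℂ) : Matrix (St N) (St N) ℂ :=
  ((List.finRange l).map fun j => Bop N (lam j)).prod

/-- The Bethe vector `B_N(λ₁) ⋯ B_N(λ_ℓ) |0⟩_N`. -/
def betheVec (N : ℕ) {l : ℕ} (lam : Fin l → ℂ) : St N → ℂ :=
  (betheProd N lam).mulVec (vac N)

/-- The eigenvalue `Λ(λ; λ₁,…,λ_ℓ)` of the transfer matrix. -/
def Lam (N : ℕ) {l : ℕ} (lam0 : ℂ) (lam : Fin l → ℂ) : ℂ :=
  (lam0 + Complex.I / 2) ^ N * ∏ j, (lam0 - lam j - Complex.I) / (lam0 - lam j) +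
    (lam0 - Complex.I / 2) ^ N * ∏ j, (lam j - lam0 - Complex.I) / (lam j - lam0)

/-- The unwanted-term coefficient `Λ_k(λ; λ₁,…,λ_ℓ)`. -/
def LamK (N : ℕ) {l : ℕ} (lam0 : ℂ) (lam : Fin l → ℂ) (k : Fin l) : ℂ :=
  Complex.I / (lam0 - lam k) *
    ((lam k + Complex.I / 2) ^ N *
        ∏ j ∈ Finset.univ.erase k, (lam k - lam j - Complex.I) / (lam k - lam j) -
      (lam k - Complex.I / 2) ^ N *
        ∏ j ∈ Finset.univ.erase k, (lam j - lam k - Complex.I) / (lam j - lam k))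

/-- The Bethe ansatz equations for the spin 1/2 XXX chain of length `N`. -/
def BetheEq (N : ℕ) {l : ℕ} (lam : Fin l → ℂ) : Prop :=
  ∀ k, ((lam k + Complex.I / 2) / (lam k - Complex.I / 2)) ^ N =
    ∏ j ∈ Finset.univ.erase k, (lam k - lam j + Complex.I) / (lam k - lam j - Complex.I)

/-- Nepomechie–Wang regularization: `λ₁(ε) = i/2 + ε + c ε^N`. -/
def nwLam1 (N : ℕ) (c : ℂ) (eps : ℂ) : ℂ := Complex.I / 2 + eps + c * eps ^ N

/-- Nepomechie–Wang regularization: `λ₂(ε) = −i/2 + ε`. -/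
def nwLam2 (eps : ℂ) : ℂ := -(Complex.I / 2) + eps

/-- The regularized tuple `(λ₁(ε), λ₂(ε), λ₃, …, λ_ℓ)`. -/
def nwTuple (N : ℕ) (c : ℂ) {m : ℕ} (mu : Fin m → ℂ) (eps : ℂ) : Fin (m + 2) → ℂ :=
  Fin.cons (nwLam1 N c eps) (Fin.cons (nwLam2 eps) mu)

/-- The singular tuple `(i/2, −i/2, λ₃, …, λ_ℓ)`. -/
def singTuple {m : ℕ} (mu : Fin m → ℂ) : Fin (m + 2) → ℂ :=
  Fin.cons (Complex.I / 2) (Fin.cons (-(Complex.I / 2)) mu)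

/-- The operator on `𝔥_N` acting as the matrix `M` on the `k`-th tensor factor and as the
identity on the others. -/
def localOp (N : ℕ) (k : Fin N) (M : Matrix (Fin 2) (Fin 2) ℂ) : Matrix (St N) (St N) ℂ :=
  Matrix.of fun x y =>
    M (x k) (y k) * ∏ j ∈ Finset.univ.erase k, (if x j = y j then (1 : ℂ) else 0)

theorem siteOp_eq_localOp (N : ℕ) (a : Fin 3) (k : Fin N) :
    siteOp N a k = localOp N k (pauli a) := rfl

theorem localOp_apply (N : ℕ) (k : Fin N) (M : Matrix (Fin 2) (Fin 2) ℂ) (x y : St N) :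
    localOp N k M x y = ∑ t, if y = Function.update x k t then M (x k) t else 0 := by
  have hprod : ∏ j ∈ Finset.univ.erase k, (if x j = y j then (1 : ℂ) else 0) =
      if ∀ j ∈ Finset.univ.erase k, x j = y j then 1 else 0 := Finset.prod_ite_zero.trans (by simp)
  have heq : ∀ t, y = Function.update x k t ↔
      (t = y k ∧ ∀ j ∈ Finset.univ.erase k, x j = y j) := by
    intro t
    rw [Function.eq_update_iff]
    constructor
    · rintro ⟨h1, h2⟩
      exact ⟨h1.symm, fun j hj => (h2 j (Finset.ne_of_mem_erase hj)).symm⟩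
    · rintro ⟨h1, h2⟩
      exact ⟨h1.symm, fun j hj => (h2 j (Finset.mem_erase.2 ⟨hj, Finset.mem_univ _⟩)).symm⟩
  simp only [localOp, Matrix.of_apply, hprod, heq, ite_and]
  simp

theorem localOp_mul_apply (N : ℕ) (k : Fin N) (M : Matrix (Fin 2) (Fin 2) ℂ)
    (Q : Matrix (St N) (St N) ℂ) (x y : St N) :
    (localOp N k M * Q) x y = ∑ t, M (x k) t * Q (Function.update x k t) y := by
  simp only [Matrix.mul_apply, localOp_apply, Finset.sum_mul, ite_mul, zero_mul]
  rw [Finset.sum_comm]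
  simp

theorem localOp_mul (N : ℕ) (k : Fin N) (M M' : Matrix (Fin 2) (Fin 2) ℂ) :
    localOp N k (M * M') = localOp N k M * localOp N k M' := by
  ext x y
  rw [localOp_mul_apply]
  simp only [localOp_apply, Matrix.mul_apply, Function.update_idem, Function.update_self,
    Finset.mul_sum, mul_ite, mul_zero]
  rw [Finset.sum_comm]
  refine Finset.sum_congr rfl fun t _ => ?_
  split_ifs <;> simp

theorem localOp_add (N : ℕ) (k : Fin N) (M M' : Matrix (Fin 2) (Fin 2) ℂ) :
    localOp N k (M + M') = localOp N k M + localOp N k M' := by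
  ext x y
  simp [localOp, add_mul]

theorem localOp_smul (N : ℕ) (k : Fin N) (c : ℂ) (M : Matrix (Fin 2) (Fin 2) ℂ) :
    localOp N k (c • M) = c • localOp N k M := by
  ext x y
  simp [localOp, mul_assoc]

theorem localOp_one (N : ℕ) (k : Fin N) : localOp N k 1 = 1 := by
  ext x y
  rw [localOp_apply]
  simp only [Matrix.one_apply, ← ite_and]
  rw [Finset.sum_eq_single (x k)]
  · simp [eq_comm]
  · intro t _ ht
    simp [ht.symm]
  · simp

theorem localOp_commute (N : ℕ) {k l : Fin N} (hkl : k ≠ l) (M M' : Matrix (Fin 2) (Fin 2) ℂ) :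
    Commute (localOp N k M) (localOp N l M') := by
  ext x y
  rw [localOp_mul_apply, localOp_mul_apply]
  simp only [localOp_apply, Finset.mul_sum, mul_ite, mul_zero]
  rw [Finset.sum_comm]
  refine Finset.sum_congr rfl fun s _ => Finset.sum_congr rfl fun t _ => ?_
  rw [Function.update_comm hkl, Function.update_of_ne hkl.symm, Function.update_of_ne hkl, mul_comm]

/-- The local form of the entries of the L-operator, as matrices on a single tensor factor. -/
def lEntry (lam : ℂ) (a b : Fin 2) : Matrix (Fin 2) (Fin 2) ℂ :=
  (if a = b then lam else 0) • 1 + (Complex.I / 2) • (pauli 0 a b • pauli 0 +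
    pauli 1 a b • pauli 1 + pauli 2 a b • pauli 2)

theorem Lop_eq_comp (N : ℕ) (lam : ℂ) (k : Fin N) :
    Lop N lam k = Matrix.compRingEquiv (Fin 2) (St N) ℂ
      (Matrix.of fun a b => localOp N k (lEntry lam a b)) := by
  ext ⟨a, x⟩ ⟨b, y⟩
  simp only [Lop, lEntry, siteOp_eq_localOp, localOp_add, localOp_smul, localOp_one,
    Fin.sum_univ_three, Matrix.compRingEquiv_apply, Matrix.comp_apply, Matrix.of_apply,
    Matrix.add_apply, Matrix.smul_apply, Matrix.one_apply, Prod.mk.injEq, smul_eq_mul, ite_and]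
  split_ifs <;> simp

section RTT

variable {R : Type*} [Ring R]

theorem commute_list_prod_apply {x : R} (l : List (Matrix (Fin 2) (Fin 2) R))
    (h : ∀ T ∈ l, ∀ a b, Commute (T a b) x) (a b : Fin 2) : Commute (l.prod a b) x := by
  induction l generalizing a b with
  | nil =>
    rw [List.prod_nil, Matrix.one_apply]
    split_ifs <;> simp
  | cons T l ih =>
    rw [List.prod_cons, Matrix.mul_apply]
    exact Commute.sum_left _ _ _ fun e _ => (h T (by simp) a e).mul_left
      (ih (fun S hS => h S (by simp [hS])) e b)

variable [Algebra ℂ R]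

/-- The `RTT` exchange relations for a pair of `2 × 2` matrices over a (noncommutative) algebra,
with R-matrix `u + k P`. -/
def ExchangeRel (u k : ℂ) (T T' : Matrix (Fin 2) (Fin 2) R) : Prop :=
  ∀ a b c d, u • (T a b * T' c d) + k • (T c b * T' a d) =
    u • (T' c d * T a b) + k • (T' c b * T a d)

theorem ExchangeRel.one (u k : ℂ) :
    ExchangeRel u k (1 : Matrix (Fin 2) (Fin 2) R) 1 := by
  intro a b c d
  simp only [Matrix.one_apply]
  split_ifs <;> simp

theorem ExchangeRel.mul {u k : ℂ} {L L' T T' : Matrix (Fin 2) (Fin 2) R}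
    (hL : ExchangeRel u k L L') (hT : ExchangeRel u k T T')
    (h : ∀ a b c d, Commute (T a b) (L' c d)) (h' : ∀ a b c d, Commute (T' a b) (L c d)) :
    ExchangeRel u k (L * T) (L' * T') := by
  intro a b c d
  have e1 : ∀ a c, ∑ e, ∑ f, L a e * L' c f * (T e b * T' f d) =
      (L * T) a b * (L' * T') c d := by
    intro a c
    simp only [Matrix.mul_apply, Finset.sum_mul_sum]
    refine Finset.sum_congr rfl fun e _ => Finset.sum_congr rfl fun f _ => ?_
    simp only [mul_assoc]
    rw [← mul_assoc (L' c f), ← (h e b c f).eq, mul_assoc]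
  have e2 : ∀ b d, ∑ e, ∑ f, L' c f * L a e * (T' f d * T e b) =
      (L' * T') c d * (L * T) a b := by
    intro b d
    simp only [Matrix.mul_apply, Finset.sum_mul_sum]
    rw [Finset.sum_comm]
    refine Finset.sum_congr rfl fun f _ => Finset.sum_congr rfl fun e _ => ?_
    simp only [mul_assoc]
    rw [← mul_assoc (L a e), ← (h' f d a e).eq, mul_assoc]
  have e3 : ∑ e, ∑ f, L' c e * L a f * (T e b * T' f d) =
      ∑ e, ∑ f, L' c f * L a e * (T f b * T' e d) := Finset.sum_comm
  calc u • ((L * T) a b * (L' * T') c d) + k • ((L * T) c b * (L' * T') a d)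
      = ∑ e, ∑ f, (u • (L a e * L' c f) + k • (L c e * L' a f)) * (T e b * T' f d) := by
        simp only [← e1, add_mul, smul_mul_assoc, Finset.sum_add_distrib, Finset.smul_sum]
    _ = ∑ e, ∑ f, (u • (L' c f * L a e) + k • (L' c e * L a f)) * (T e b * T' f d) := by
        simp only [hL a _ c _]
    _ = ∑ e, ∑ f, L' c f * L a e * (u • (T e b * T' f d) + k • (T f b * T' e d)) := by
        simp only [add_mul, mul_add, smul_mul_assoc, mul_smul_comm, Finset.sum_add_distrib,
          ← Finset.smul_sum, e3]
    _ = ∑ e, ∑ f, L' c f * L a e * (u • (T' f d * T e b) + k • (T' f b * T e d)) := by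
        simp only [hT _ b _ d]
    _ = _ := by
        simp only [← e2, mul_add, mul_smul_comm, Finset.sum_add_distrib, Finset.smul_sum]

theorem ExchangeRel.list_prod {ι : Type*} {u k : ℂ} (L L' : ι → Matrix (Fin 2) (Fin 2) R)
    (hL : ∀ i, ExchangeRel u k (L i) (L' i))
    (h : ∀ i j, i ≠ j → ∀ a b c d, Commute (L i a b) (L' j c d))
    (l : List ι) (hl : l.Nodup) : ExchangeRel u k (l.map L).prod (l.map L').prod := by
  induction l with
  | nil => exact ExchangeRel.one u k
  | cons i l ih =>
    obtain ⟨hi, hl⟩ := List.nodup_cons.1 hl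
    simp only [List.map_cons, List.prod_cons]
    refine (hL i).mul (ih hl) (fun a b c d => commute_list_prod_apply _ ?_ a b)
      (fun a b c d => commute_list_prod_apply _ ?_ a b)
    · rintro _ hT a b
      obtain ⟨j, hj, rfl⟩ := List.mem_map.1 hT
      exact h j i (fun e => hi (e ▸ hj)) _ _ _ _
    · rintro _ hT a b
      obtain ⟨j, hj, rfl⟩ := List.mem_map.1 hT
      exact (h i j (fun e => hi (e ▸ hj)) _ _ _ _).symm

theorem ExchangeRel.commute_trace {u k : ℂ} (hu : u ≠ 0) {T T' : Matrix (Fin 2) (Fin 2) R}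
    (h : ExchangeRel u k T T') (h' : ExchangeRel (-u) k T' T) :
    Commute T.trace T'.trace := by
  have key : (2 * u) • (T.trace * T'.trace - T'.trace * T.trace) = 0 := by
    have s : ∑ a, ∑ c, (u • (T a a * T' c c) + k • (T c a * T' a c) -
        (u • (T' c c * T a a) + k • (T' c a * T a c))) = 0 :=
      Finset.sum_eq_zero fun a _ => Finset.sum_eq_zero fun c _ => sub_eq_zero.2 (h a a c c)
    have s' : ∑ a, ∑ c, (-u • (T' a a * T c c) + k • (T' c a * T a c) -
        (-u • (T c c * T' a a) + k • (T c a * T' a c))) = 0 :=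
      Finset.sum_eq_zero fun a _ => Finset.sum_eq_zero fun c _ => sub_eq_zero.2 (h' a a c c)
    rw [← add_zero (0 : R)]
    nth_rw 1 [← s]
    rw [← s']
    simp only [Matrix.trace_fin_two, Fin.sum_univ_two, mul_add, add_mul]
    module
  exact sub_eq_zero.1 ((smul_eq_zero.1 key).resolve_left (by simpa using hu))

end RTT

theorem lEntry_eq (lam : ℂ) (a b : Fin 2) :
    lEntry lam a b = ((lam - Complex.I / 2) * (1 : Matrix (Fin 2) (Fin 2) ℂ) a b) • 1 +
      Complex.I • Matrix.single b a 1 := by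
  have hI : Complex.I ^ 2 = -1 := Complex.I_sq
  ext i j
  fin_cases a <;> fin_cases b <;> fin_cases i <;> fin_cases j <;>
    simp [lEntry, pauli] <;> grind

theorem single_one_mul_single_one (a b c d : Fin 2) :
    Matrix.single b a (1 : ℂ) * Matrix.single d c 1 =
      (1 : Matrix (Fin 2) (Fin 2) ℂ) a d • Matrix.single b c 1 := by
  by_cases h : a = d
  · subst h
    simp
  · simp [h]

theorem lEntry_exchangeRel (lam mu : ℂ) :
    ExchangeRel (lam - mu) Complex.I (Matrix.of (lEntry lam)) (Matrix.of (lEntry mu)) := by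
  intro a b c d
  simp only [Matrix.of_apply, lEntry_eq, add_mul, mul_add, smul_mul_assoc, mul_smul_comm, one_mul,
    mul_one, single_one_mul_single_one]
  module

theorem localOp_exchangeRel (N : ℕ) (k : Fin N) (lam mu : ℂ) :
    ExchangeRel (lam - mu) Complex.I (Matrix.of fun a b => localOp N k (lEntry lam a b))
      (Matrix.of fun a b => localOp N k (lEntry mu a b)) := by
  intro a b c d
  have := congrArg (localOp N k) (lEntry_exchangeRel lam mu a b c d)
  simpa only [localOp_add, localOp_smul, localOp_mul, Matrix.of_apply] using this

/-- The monodromy matrix as a `2 × 2` matrix of operators on `𝔥_N`. -/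
def blockMonodromy (N : ℕ) (lam : ℂ) : Matrix (Fin 2) (Fin 2) (Matrix (St N) (St N) ℂ) :=
  ((List.finRange N).reverse.map fun k =>
    (Matrix.of fun a b => localOp N k (lEntry lam a b) :
      Matrix (Fin 2) (Fin 2) (Matrix (St N) (St N) ℂ))).prod

theorem monodromy_eq_comp (N : ℕ) (lam : ℂ) :
    monodromy N lam = Matrix.compRingEquiv (Fin 2) (St N) ℂ (blockMonodromy N lam) := by
  rw [monodromy, blockMonodromy, map_list_prod, List.map_map]
  congr 2
  funext k
  exact Lop_eq_comp N lam k

theorem tau_eq_trace (N : ℕ) (lam : ℂ) : tau N lam = (blockMonodromy N lam).trace := by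
  rw [Matrix.trace_fin_two]
  ext x y
  simp [tau, Aop, Dop, monodromy_eq_comp, Matrix.comp_apply]

theorem blockMonodromy_exchangeRel (N : ℕ) (lam mu : ℂ) :
    ExchangeRel (lam - mu) Complex.I (blockMonodromy N lam) (blockMonodromy N mu) :=
  ExchangeRel.list_prod _ _ (fun k => localOp_exchangeRel N k lam mu)
    (fun _ _ hij _ _ _ _ => localOp_commute N hij _ _) _
    (List.nodup_reverse.2 (List.nodup_finRange N))

/-- The transfer matrices commute: `τ_N(λ) τ_N(μ) = τ_N(μ) τ_N(λ)`. -/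
theorem transfer_matrices_commute (N : ℕ) (hN : 1 ≤ N) (lam mu : ℂ) :
    tau N lam * tau N mu = tau N mu * tau N lam := by
  rcases eq_or_ne lam mu with rfl | hne
  · rfl
  · rw [tau_eq_trace, tau_eq_trace]
    refine (blockMonodromy_exchangeRel N lam mu).commute_trace (sub_ne_zero.2 hne) ?_
    rw [neg_sub]
    exact blockMonodromy_exchangeRel N mu lam
end
end

section
/- The operator τ_N(i/2) is invertible, and the XXX Hamiltonian is recovered as ℋ_N = (iJ/2) · τ_N(i/2)⁻¹ · τ_N′(i/2) − (NJ/2) · 𝟙, where τ_N′(i/2) denotes the derivative at λ = i/2 of the (entrywise polynomial) operator-valued function λ ↦ τ_N(λ). -/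
open Complex Matrix Filter Topology

noncomputable section

/-- The operator on `(ℂ²)^{⊗ι}` permuting the tensor factors by `σ`. -/
def factorPerm {ι : Type*} [Fintype ι] [DecidableEq ι] (σ : Equiv.Perm ι) :
    Matrix (ι → Fin 2) (ι → Fin 2) ℂ :=
  Matrix.of fun x y => if y = x ∘ σ then 1 else 0

theorem factorPerm_mul {ι : Type*} [Fintype ι] [DecidableEq ι] (σ ρ : Equiv.Perm ι) :
    factorPerm σ * factorPerm ρ = factorPerm (σ * ρ) := by
  ext x y
  simp only [factorPerm, Matrix.mul_apply, Matrix.of_apply, ite_mul, one_mul, zero_mul,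
    Finset.sum_ite_eq', Finset.mem_univ, if_true, Function.comp_assoc, Equiv.Perm.coe_mul]
  congr

theorem factorPerm_one {ι : Type*} [Fintype ι] [DecidableEq ι] :
    factorPerm (1 : Equiv.Perm ι) = 1 := by
  ext x y
  simp [factorPerm, Matrix.one_apply, eq_comm]

/-- Basis states of `ℂ² ⊗ 𝔥_N`, with `none` as the label of the auxiliary factor. -/
def auxEquiv (N : ℕ) : Fin 2 × St N ≃ (Option (Fin N) → Fin 2) where
  toFun p o := o.elim p.1 p.2
  invFun f := (f none, fun k => f (some k))
  left_inv _ := rfl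
  right_inv f := by
    ext o
    cases o <;> rfl

/-- The operator on `ℂ² ⊗ 𝔥_N` permuting the tensor factors, auxiliary one included. -/
def auxPerm {N : ℕ} (π : Equiv.Perm (Option (Fin N))) :
    Matrix (Fin 2 × St N) (Fin 2 × St N) ℂ :=
  (factorPerm π).submatrix (auxEquiv N) (auxEquiv N)

theorem auxPerm_mul {N : ℕ} (π ρ : Equiv.Perm (Option (Fin N))) :
    auxPerm π * auxPerm ρ = auxPerm (π * ρ) := by
  rw [auxPerm, auxPerm, Matrix.submatrix_mul_equiv, factorPerm_mul, auxPerm]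

theorem auxPerm_one {N : ℕ} : auxPerm (1 : Equiv.Perm (Option (Fin N))) = 1 := by
  rw [auxPerm, factorPerm_one, Matrix.submatrix_one_equiv]

theorem auxPerm_apply {N : ℕ} (π : Equiv.Perm (Option (Fin N))) (b c : Fin 2) (x y : St N) :
    auxPerm π (b, x) (c, y) =
      if c = (π none).elim b x ∧ ∀ k, y k = (π (some k)).elim b x then 1 else 0 := by
  simp only [auxPerm, factorPerm, Matrix.submatrix_apply, Matrix.of_apply, funext_iff,
    Option.forall, Function.comp_apply]
  rfl

/-- The partial trace over the auxiliary factor. -/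
def auxTrace {N : ℕ} :
    Matrix (Fin 2 × St N) (Fin 2 × St N) ℂ →ₗ[ℂ] Matrix (St N) (St N) ℂ where
  toFun M := Matrix.of fun x y => ∑ b, M (b, x) (b, y)
  map_add' M M' := by
    ext x y
    simp [Finset.sum_add_distrib]
  map_smul' r M := by
    ext x y
    simp [mul_add]

theorem auxTrace_apply {N : ℕ} (M : Matrix (Fin 2 × St N) (Fin 2 × St N) ℂ) (x y : St N) :
    auxTrace M x y = ∑ b, M (b, x) (b, y) := rfl

theorem auxTrace_one {N : ℕ} :
    auxTrace (1 : Matrix (Fin 2 × St N) (Fin 2 × St N) ℂ) = (2 : ℂ) • 1 := by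
  ext x y
  simp [auxTrace_apply, Matrix.one_apply]

theorem some_removeNone {α : Type*} [DecidableEq α] (π : Equiv.Perm (Option α)) (k : α) :
    some (Equiv.removeNone π k) = if π (some k) = none then π none else π (some k) := by
  split_ifs with h
  · exact Equiv.removeNone_none π h
  · exact Equiv.removeNone_some π (Option.ne_none_iff_exists'.1 h)

theorem auxTrace_auxPerm {N : ℕ} (π : Equiv.Perm (Option (Fin N))) (h : π none ≠ none) :
    auxTrace (auxPerm π) = factorPerm (Equiv.removeNone π) := by
  obtain ⟨m, hm⟩ := Option.ne_none_iff_exists'.1 h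
  ext x y
  have key : ∀ k, (π (some k)).elim (x m) x = x (Equiv.removeNone π k) := by
    intro k
    have hk := some_removeNone π k
    rcases h' : π (some k) with _ | j <;> simp_all
  simp only [auxTrace_apply, auxPerm_apply, hm, Option.elim_some, ite_and, Finset.sum_ite_eq',
    Finset.mem_univ, if_true, key, factorPerm, Matrix.of_apply, funext_iff, Function.comp_apply]

theorem removeNone_swap_mul {N : ℕ} (π : Equiv.Perm (Option (Fin N))) (h : π none ≠ none)
    (k : Fin N) (hk : Equiv.removeNone π k ≠ k) :
    (Equiv.swap (some k) (π (some k)) * π) none ≠ none ∧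
    Equiv.removeNone (Equiv.swap (some k) (π (some k)) * π) =
      Equiv.swap k (Equiv.removeNone π k) * Equiv.removeNone π := by
  have hck := some_removeNone π k
  refine ⟨?_, Equiv.ext fun j => Option.some_injective _ ?_⟩
  · have hinj : π (some k) ≠ π none := π.injective.ne (by simp)
    simp only [Equiv.Perm.mul_apply, Equiv.swap_apply_def]
    grind
  · have hcj := some_removeNone π j
    have hinj : π (some k) ≠ π none := π.injective.ne (by simp)
    have hinj' : π (some j) ≠ π none := π.injective.ne (by simp)
    have hinj'' : π (some j) = π (some k) → j = k := fun h => by simpa using h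
    simp only [some_removeNone, Equiv.Perm.mul_apply, Equiv.swap_apply_def]
    grind

theorem pauli_exchange (p q b d : Fin 2) :
    ∑ a, pauli a p b * pauli a q d =
      2 * (if b = q ∧ d = p then 1 else 0) - (if b = p ∧ d = q then 1 else 0) := by
  fin_cases p <;> fin_cases q <;> fin_cases b <;> fin_cases d <;>
    simp [Fin.sum_univ_three, pauli] <;> norm_num

theorem pauli_exchange_sum (p q b : Fin 2) (F : Fin 2 → ℂ) :
    ∑ d, (∑ a, pauli a p b * pauli a q d) * F d =
      2 * (if b = q then F p else 0) - (if b = p then F q else 0) := by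
  simp only [pauli_exchange, sub_mul, Finset.sum_sub_distrib, ite_and, mul_ite, ite_mul, mul_one,
    mul_zero, one_mul, zero_mul]
  split_ifs <;> simp only [Finset.sum_ite_eq', Finset.mem_univ, if_true, Finset.sum_const_zero]

theorem pauli_casimir (p d : Fin 2) :
    ∑ a, ∑ b, pauli a p b * pauli a b d = if d = p then 3 else 0 := by
  fin_cases p <;> fin_cases d <;>
    simp [Fin.sum_univ_three, pauli] <;> norm_num

theorem siteOp_apply {N : ℕ} (a : Fin 3) (k : Fin N) (x y : St N) :
    siteOp N a k x y =
      ∑ d, pauli a (x k) d * if y = Function.update x k d then 1 else 0 := by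
  have h : ∀ d, y = Function.update x k d ↔ d = y k ∧ ∀ j ∈ Finset.univ.erase k, x j = y j := by
    intro d
    rw [Function.eq_update_iff]
    simp only [Finset.mem_erase, Finset.mem_univ, and_true, eq_comm]
  simp only [siteOp, Matrix.of_apply, Finset.prod_ite_zero, Finset.prod_const_one, h, ite_and,
    mul_ite, mul_one, mul_zero, Finset.sum_ite_eq', Finset.mem_univ, if_true]

theorem siteOp_mul_apply {N : ℕ} (a : Fin 3) (k : Fin N) (M : Matrix (St N) (St N) ℂ)
    (x y : St N) :
    (siteOp N a k * M) x y = ∑ b, pauli a (x k) b * M (Function.update x k b) y := by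
  simp only [Matrix.mul_apply, siteOp_apply, Finset.sum_mul]
  rw [Finset.sum_comm]
  simp

theorem sum_siteOp_mul_self {N : ℕ} (k : Fin N) :
    ∑ a, siteOp N a k * siteOp N a k = (3 : ℂ) • 1 := by
  ext x y
  simp only [Matrix.sum_apply, siteOp_mul_apply, siteOp_apply, Function.update_self,
    Function.update_idem, Finset.mul_sum]
  have : ∀ a, ∑ b, ∑ d, pauli a (x k) b *
      (pauli a b d * if y = Function.update x k d then 1 else 0) =
      ∑ d, (∑ b, pauli a (x k) b * pauli a b d) * if y = Function.update x k d then 1 else 0 := by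
    intro a
    rw [Finset.sum_comm]
    simp only [Finset.sum_mul, mul_assoc]
  simp only [this]
  rw [Finset.sum_comm]
  simp only [← Finset.sum_mul, pauli_casimir, ite_mul, zero_mul, Finset.sum_ite_eq',
    Finset.mem_univ, if_true, Function.update_eq_self]
  simp [Matrix.one_apply, eq_comm]

theorem sum_siteOp_mul {N : ℕ} {i j : Fin N} (hij : i ≠ j) :
    ∑ a, siteOp N a i * siteOp N a j = (2 : ℂ) • factorPerm (Equiv.swap i j) - 1 := by
  ext x y
  simp only [Matrix.sum_apply, siteOp_mul_apply, siteOp_apply, Function.update_of_ne hij.symm,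
    Finset.mul_sum, ← mul_assoc]
  rw [Finset.sum_comm]
  have : ∀ b, ∑ a, ∑ d, pauli a (x i) b * pauli a (x j) d *
      (if y = Function.update (Function.update x i b) j d then (1 : ℂ) else 0) =
      ∑ d, (∑ a, pauli a (x i) b * pauli a (x j) d) *
        (if y = Function.update (Function.update x i b) j d then (1 : ℂ) else 0) := by
    intro b
    rw [Finset.sum_comm]
    simp only [← Finset.sum_mul]
  simp only [this, pauli_exchange_sum, Finset.sum_sub_distrib]
  simp only [← Finset.mul_sum, Finset.sum_ite_eq', Finset.mem_univ, if_true]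
  simp [factorPerm, Matrix.one_apply, Equiv.comp_swap_eq_update, eq_comm,
    Function.update_comm hij]

theorem Lop_eq {N : ℕ} (lam : ℂ) (k : Fin N) :
    Lop N lam k = (lam - Complex.I / 2) • 1 +
      Complex.I • auxPerm (Equiv.swap none (some k)) := by
  ext ⟨b, x⟩ ⟨c, y⟩
  have h : ∑ a, pauli a b c * siteOp N a k x y =
      2 * (if c = x k ∧ y = Function.update x k b then 1 else 0) -
        (if c = b ∧ y = x then 1 else 0) := by
    simp only [siteOp_apply, Finset.mul_sum, ← mul_assoc]
    rw [Finset.sum_comm]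
    simp only [← Finset.sum_mul, pauli_exchange_sum, Function.update_eq_self, ite_and]
  have h' : auxPerm (Equiv.swap none (some k)) (b, x) (c, y) =
      if c = x k ∧ y = Function.update x k b then 1 else 0 := by
    rw [auxPerm_apply]
    have : (∀ j, y j = (Equiv.swap none (some k) (some j)).elim b x) ↔
        y = Function.update x k b := by
      rw [funext_iff]
      refine forall_congr' fun j => ?_
      rcases eq_or_ne j k with rfl | hj
      · simp
      · simp [Equiv.swap_apply_of_ne_of_ne, hj]
    rw [Equiv.swap_apply_left, Option.elim_some]
    simp only [this]
  have h1 : (1 : Matrix (Fin 2 × St N) (Fin 2 × St N) ℂ) (b, x) (c, y) =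
      if c = b ∧ y = x then 1 else 0 := by
    simp [Matrix.one_apply, eq_comm]
  simp only [Lop, Matrix.add_apply, Matrix.smul_apply, Matrix.sum_apply, Matrix.of_apply, h, h',
    h1, smul_eq_mul]
  ring

/-- The product of the transpositions of `none` with the entries of a list, last entry
leftmost. -/
def starPerm {N : ℕ} (l : List (Fin N)) : Equiv.Perm (Option (Fin N)) :=
  (l.reverse.map fun k => Equiv.swap none (some k)).prod

theorem starPerm_cons {N : ℕ} (k : Fin N) (l : List (Fin N)) :
    starPerm (k :: l) = starPerm l * Equiv.swap none (some k) := by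
  simp [starPerm]

theorem starPerm_append {N : ℕ} (l l' : List (Fin N)) :
    starPerm (l ++ l') = starPerm l' * starPerm l := by
  simp [starPerm]

theorem starPerm_some {N : ℕ} {k : Fin N} {l : List (Fin N)} (h : k ∉ l) :
    starPerm l (some k) = some k := by
  induction l with
  | nil => rfl
  | cons j l ih =>
    rw [List.mem_cons, not_or] at h
    rw [starPerm_cons, Equiv.Perm.mul_apply,
      Equiv.swap_apply_of_ne_of_ne (by simp) (by simpa using h.1), ih h.2]

theorem starPerm_none {N : ℕ} {l : List (Fin N)} (h : l.Nodup) :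
    starPerm l none = l.head? := by
  cases l with
  | nil => rfl
  | cons j l =>
    rw [starPerm_cons, Equiv.Perm.mul_apply, Equiv.swap_apply_left,
      starPerm_some (List.nodup_cons.1 h).1, List.head?_cons]

theorem starPerm_finRange_some {N : ℕ} (k : Fin N) :
    starPerm (List.finRange N) (some k) = (List.finRange N)[k.1 + 1]? := by
  have hlen : k.1 < (List.finRange N).length := by simp
  have hsplit : List.finRange N =
      (List.finRange N).take k ++ k :: (List.finRange N).drop (k + 1) := by
    conv_lhs => rw [← List.take_append_drop k.1 (List.finRange N),
      List.drop_eq_getElem_cons hlen]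
    simp
  have hnd := List.nodup_finRange N
  rw [hsplit, List.nodup_append, List.nodup_cons] at hnd
  obtain ⟨-, ⟨-, hnd⟩, hdis⟩ := hnd
  conv_lhs => rw [hsplit]
  rw [starPerm_append, Equiv.Perm.mul_apply,
    starPerm_some fun hk => hdis k hk k List.mem_cons_self rfl,
    starPerm_cons, Equiv.Perm.mul_apply, Equiv.swap_apply_right, starPerm_none hnd,
    List.head?_drop]

theorem starPerm_finRange_none {N : ℕ} (hN : 1 ≤ N) :
    starPerm (List.finRange N) none = some ⟨0, hN⟩ := by
  rw [starPerm_none (List.nodup_finRange N)]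
  obtain ⟨n, rfl⟩ := Nat.exists_eq_add_of_le' hN
  simp [List.finRange_succ]

theorem removeNone_starPerm_finRange {N : ℕ} (k : Fin N) :
    Equiv.removeNone (starPerm (List.finRange N)) k = cyc k := by
  have hs := starPerm_finRange_some k
  rcases lt_or_ge (k.1 + 1) N with h | h
  · rw [List.getElem?_eq_getElem (by simpa using h)] at hs
    have := Equiv.removeNone_some _ ⟨_, hs⟩
    rw [hs] at this
    rw [Option.some.inj this]
    ext
    simp [cyc, Nat.mod_eq_of_lt h]
  · rw [List.getElem?_eq_none (by simpa using h)] at hs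
    have := Equiv.removeNone_none _ hs
    rw [starPerm_finRange_none k.pos] at this
    rw [Option.some.inj this]
    have : k.1 + 1 = N := by omega
    ext
    simp [cyc, this]

theorem prod_Lop_eq {N : ℕ} (l : List (Fin N)) :
    (l.reverse.map (Lop N (Complex.I / 2))).prod =
      Complex.I ^ l.length • auxPerm (starPerm l) := by
  induction l with
  | nil => simp [starPerm, auxPerm_one]
  | cons k l ih =>
    rw [List.reverse_cons, List.map_append, List.prod_append, ih, starPerm_cons, ← auxPerm_mul]
    simp [Lop_eq, smul_smul, pow_succ, mul_comm]

theorem hasDerivAt_prod_Lop {N : ℕ} {l : List (Fin N)} (hl : l.Nodup) (p q : Fin 2 × St N) :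
    HasDerivAt (fun z => (l.reverse.map (Lop N z)).prod p q)
      (((-Complex.I * Complex.I ^ l.length) • (l.map fun k =>
        auxPerm (Equiv.swap (some k) (starPerm l (some k)) * starPerm l)).sum) p q)
      (Complex.I / 2) := by
  induction l generalizing p q with
  | nil => simpa using hasDerivAt_const _ _
  | cons k l ih =>
    obtain ⟨hk, hl⟩ := List.nodup_cons.1 hl
    have hL : ∀ p q, HasDerivAt (fun z => Lop N z k p q)
        ((1 : Matrix (Fin 2 × St N) (Fin 2 × St N) ℂ) p q) (Complex.I / 2) := by
      intro p q
      simp only [Lop_eq, Matrix.add_apply, Matrix.smul_apply, smul_eq_mul]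
      simpa using ((((hasDerivAt_id (Complex.I / 2)).sub_const (Complex.I / 2)).mul_const
        ((1 : Matrix (Fin 2 × St N) (Fin 2 × St N) ℂ) p q)).add_const
        (Complex.I * auxPerm (Equiv.swap none (some k)) p q))
    have hsum := HasDerivAt.fun_sum (u := Finset.univ) fun r _ => (ih hl p r).mul (hL r q)
    have hfun : (fun z => ((k :: l).reverse.map (Lop N z)).prod p q) =
        fun z => ∑ r, (l.reverse.map (Lop N z)).prod p r * Lop N z k r q := by
      funext z
      simp [Matrix.mul_apply]
    rw [hfun]
    refine hsum.congr_deriv ?_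
    rw [Finset.sum_add_distrib, ← Matrix.mul_apply, ← Matrix.mul_apply, mul_one, prod_Lop_eq,
      ← Matrix.add_apply]
    have hmap : (l.map fun j =>
        auxPerm (Equiv.swap (some j) (starPerm (k :: l) (some j)) * starPerm (k :: l))) =
        l.map fun j => auxPerm (Equiv.swap (some j) (starPerm l (some j)) * starPerm l) *
          auxPerm (Equiv.swap none (some k)) := by
      refine List.map_congr_left fun j hj => ?_
      have hjk : j ≠ k := fun h => hk (h ▸ hj)
      rw [auxPerm_mul, starPerm_cons, Equiv.Perm.mul_apply,
        Equiv.swap_apply_of_ne_of_ne (by simp) (by simpa using hjk), mul_assoc]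
    have hhead : Equiv.swap (some k) (starPerm (k :: l) (some k)) * starPerm (k :: l) =
        starPerm l := by
      rw [starPerm_cons, Equiv.Perm.mul_apply, Equiv.swap_apply_right]
      nth_rewrite 1 [← starPerm_some hk]
      rw [← mul_assoc, ← Equiv.mul_swap_eq_swap_mul, mul_assoc, Equiv.swap_comm,
        Equiv.swap_mul_self, mul_one]
    have hI : -Complex.I * Complex.I ^ (l.length + 1) = Complex.I ^ l.length := by
      rw [pow_succ, neg_mul, mul_left_comm, Complex.I_mul_I]
      ring
    rw [List.map_cons, List.sum_cons, hmap, hhead, List.sum_map_mul_right, List.length_cons,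
      smul_add, hI, Lop_eq, sub_self, zero_smul, zero_add, Matrix.smul_mul, Matrix.mul_smul,
      smul_smul, add_comm]
    rw [mul_assoc, ← pow_succ, hI]

theorem tau_eq_auxTrace (N : ℕ) (lam : ℂ) : tau N lam = auxTrace (monodromy N lam) := by
  ext x y
  simp [tau, Aop, Dop, auxTrace_apply]

theorem tau_half_I {N : ℕ} (hN : 1 ≤ N) :
    tau N (Complex.I / 2) =
      Complex.I ^ N • factorPerm (Equiv.removeNone (starPerm (List.finRange N))) := by
  rw [tau_eq_auxTrace, monodromy, prod_Lop_eq, map_smul, List.length_finRange,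
    auxTrace_auxPerm _ (by simp [starPerm_finRange_none hN])]

theorem deriv_tau_half_I (N : ℕ) :
    (Matrix.of fun x y => deriv (fun z => tau N z x y) (Complex.I / 2)) =
      (-Complex.I * Complex.I ^ N) • ∑ k, auxTrace (auxPerm
        (Equiv.swap (some k) (starPerm (List.finRange N) (some k)) *
          starPerm (List.finRange N))) := by
  rw [← map_sum, ← map_smul]
  ext x y
  rw [Matrix.of_apply]
  simp only [tau_eq_auxTrace, auxTrace_apply]
  have h := HasDerivAt.fun_sum (u := Finset.univ) fun b (_ : b ∈ Finset.univ) =>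
    hasDerivAt_prod_Lop (List.nodup_finRange N) (b, x) (b, y)
  rw [List.length_finRange, ← List.ofFn_eq_map, List.sum_ofFn] at h
  exact h.deriv

theorem cyc_ne_self {N : ℕ} (hN : 2 ≤ N) (k : Fin N) : cyc k ≠ k := by
  intro h
  have h' := congrArg Fin.val h
  simp only [cyc] at h'
  rcases Nat.lt_or_ge (k.1 + 1) N with hk | hk
  · rw [Nat.mod_eq_of_lt hk] at h'
    omega
  · rw [show k.1 + 1 = N by omega, Nat.mod_self] at h'
    omega

/-- The logarithmic derivative of the transfer matrix, as a sum of local terms. -/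
theorem deriv_tau_eq_tau_mul {N : ℕ} (hN : 1 ≤ N) :
    (Matrix.of fun x y => deriv (fun z => tau N z x y) (Complex.I / 2)) =
      tau N (Complex.I / 2) * (-Complex.I / 2) •
        ∑ k, (∑ a, siteOp N a k * siteOp N a (cyc k) + 1) := by
  rw [deriv_tau_half_I, tau_half_I hN, Matrix.smul_mul, Matrix.mul_smul, smul_smul]
  have hnone : starPerm (List.finRange N) none ≠ none := by simp [starPerm_finRange_none hN]
  rcases Nat.eq_or_lt_of_le hN with rfl | hN2
  · have hc : Equiv.removeNone (starPerm (List.finRange 1)) = 1 := Subsingleton.elim _ _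
    have hp : Equiv.swap (some 0) (starPerm (List.finRange 1) (some 0)) *
        starPerm (List.finRange 1) = 1 := by
      simp [starPerm, List.finRange_succ, Equiv.swap_comm]
    have hcyc : cyc (0 : Fin 1) = 0 := Subsingleton.elim _ _
    rw [Fin.sum_univ_one, Fin.sum_univ_one, hp, auxPerm_one, auxTrace_one, hc, factorPerm_one,
      one_mul, hcyc, sum_siteOp_mul_self]
    module
  · set c := Equiv.removeNone (starPerm (List.finRange N)) with hc
    have hck : ∀ k, c k = cyc k := removeNone_starPerm_finRange
    have hne : ∀ k, c k ≠ k := fun k => hck k ▸ cyc_ne_self hN2 k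
    have hleft : ∀ k, auxTrace (auxPerm
        (Equiv.swap (some k) (starPerm (List.finRange N) (some k)) *
          starPerm (List.finRange N))) =
        factorPerm c * factorPerm (Equiv.swap (c.symm k) (c (c.symm k))) := by
      intro k
      obtain ⟨h1, h2⟩ := removeNone_swap_mul _ hnone k (hne k)
      rw [auxTrace_auxPerm _ h1, h2, factorPerm_mul, ← hc, Equiv.mul_swap_eq_swap_mul,
        Equiv.apply_symm_apply]
    have hright : ∀ k, ∑ a, siteOp N a k * siteOp N a (cyc k) + 1 =
        (2 : ℂ) • factorPerm (Equiv.swap k (c k)) := by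
      intro k
      rw [sum_siteOp_mul (cyc_ne_self hN2 k).symm, sub_add_cancel, hck]
    simp only [hleft, hright]
    rw [Equiv.sum_comp c.symm fun k => factorPerm c * factorPerm (Equiv.swap k (c k)),
      ← Finset.mul_sum, ← Finset.smul_sum, Matrix.mul_smul, smul_smul]
    congr 1
    ring

/-- `τ_N(i/2)` is invertible and
`ℋ_N = (iJ/2) τ_N(i/2)⁻¹ τ_N′(i/2) − (NJ/2) 𝟙`, where `τ_N′(i/2)` is the
entrywise derivative of `λ ↦ τ_N(λ)` at `λ = i/2`. -/
theorem hamiltonian_from_transfer_matrix (N : ℕ) (hN : 1 ≤ N) (J : ℝ) :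
    IsUnit (tau N (Complex.I / 2)) ∧
    Ham N J =
      (Complex.I * J / 2) •
        ((tau N (Complex.I / 2))⁻¹ *
          Matrix.of fun x y => deriv (fun z => tau N z x y) (Complex.I / 2)) -
      ((N : ℂ) * J / 2) • 1 := by
  have hunit : IsUnit (tau N (Complex.I / 2)) := by
    refine IsUnit.of_mul_eq_one ((Complex.I ^ N)⁻¹ •
      factorPerm (Equiv.removeNone (starPerm (List.finRange N)))⁻¹) ?_
    rw [tau_half_I hN, smul_mul_smul_comm, factorPerm_mul, mul_inv_cancel, factorPerm_one,
      mul_inv_cancel₀ (pow_ne_zero _ Complex.I_ne_zero), one_smul]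
  refine ⟨hunit, ?_⟩
  rw [deriv_tau_eq_tau_mul hN, ← mul_assoc,
    Matrix.nonsing_inv_mul _ ((Matrix.isUnit_iff_isUnit_det _).1 hunit), one_mul, smul_smul, Ham,
    Finset.sum_sub_distrib, Finset.sum_add_distrib]
  have hI : Complex.I * J / 2 * (-Complex.I / 2) = (J : ℂ) / 4 := by
    linear_combination (-(J : ℂ) / 4) * Complex.I_mul_I
  rw [hI, Finset.sum_const, Finset.card_univ, Fintype.card_fin, ← Nat.cast_smul_eq_nsmul ℂ]
  module
end
end

section
/- Let λ, λ₁, …, λ_ℓ ∈ ℂ be pairwise distinct. Then (A_N(λ) + D_N(λ)) B_N(λ₁) ⋯ B_N(λ_ℓ) |0⟩_N = Λ(λ; λ₁,…,λ_ℓ) ∏_{j=1}^{ℓ} B_N(λ_j) |0⟩_N + Σ_{k=1}^{ℓ} Λ_k(λ; λ₁,…,λ_ℓ) B_N(λ) ∏_{j≠k} B_N(λ_j) |0⟩_N. -/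
open Complex Matrix Filter Topology

noncomputable section

/-- The operator on `𝔥_N` acting as `M` on the `k`-th tensor factor. -/
def siteMatrix (N : ℕ) (k : Fin N) (M : Matrix (Fin 2) (Fin 2) ℂ) : Matrix (St N) (St N) ℂ :=
  Matrix.of fun x y =>
    M (x k) (y k) * ∏ j ∈ Finset.univ.erase k, (if x j = y j then (1 : ℂ) else 0)

theorem siteMatrix_apply (N : ℕ) (k : Fin N) (M : Matrix (Fin 2) (Fin 2) ℂ) (x y : St N) :
    siteMatrix N k M x y = ∑ s, if Function.update x k s = y then M (x k) s else 0 := by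
  have hprod : ∏ j ∈ Finset.univ.erase k, (if x j = y j then (1 : ℂ) else 0) =
      if Function.update x k (y k) = y then 1 else 0 := by
    rw [Finset.prod_ite_zero]
    simp [Function.update_eq_iff]
  rw [Finset.sum_eq_single (y k)]
  · simp [siteMatrix, hprod]
  · intro s _ hs
    rw [if_neg]
    rintro rfl
    simp at hs
  · simp

theorem siteMatrix_mulVec (N : ℕ) (k : Fin N) (M : Matrix (Fin 2) (Fin 2) ℂ) (v : St N → ℂ)
    (x : St N) : (siteMatrix N k M *ᵥ v) x = ∑ s, M (x k) s * v (Function.update x k s) := by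
  simp only [mulVec, dotProduct, siteMatrix_apply, Finset.sum_mul, ite_mul, zero_mul]
  rw [Finset.sum_comm]
  simp

/-- The algebra embedding of `2 × 2` matrices as operators on the `k`-th tensor factor. -/
def siteHom (N : ℕ) (k : Fin N) :
    Matrix (Fin 2) (Fin 2) ℂ →ₐ[ℂ] Matrix (St N) (St N) ℂ :=
  AlgHom.ofLinearMap
    { toFun := siteMatrix N k
      map_add' := fun M M' => by ext; simp [siteMatrix, add_mul]
      map_smul' := fun c M => by ext; simp [siteMatrix, mul_assoc] }
    (by
      refine ext_iff_mulVec.mpr fun v => funext fun x => ?_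
      simp [siteMatrix_mulVec, one_apply])
    (fun M M' => by
      refine ext_iff_mulVec.mpr fun v => funext fun x => ?_
      simp only [LinearMap.coe_mk, AddHom.coe_mk, ← mulVec_mulVec, siteMatrix_mulVec]
      simp [mul_apply, mul_add]
      ring)

theorem siteHom_mulVec (N : ℕ) (k : Fin N) (M : Matrix (Fin 2) (Fin 2) ℂ) (v : St N → ℂ)
    (x : St N) : (siteHom N k M *ᵥ v) x = ∑ s, M (x k) s * v (Function.update x k s) :=
  siteMatrix_mulVec N k M v x

theorem commute_siteHom {N : ℕ} {k k' : Fin N} (h : k ≠ k') (M M' : Matrix (Fin 2) (Fin 2) ℂ) :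
    Commute (siteHom N k M) (siteHom N k' M') := by
  refine ext_iff_mulVec.mpr fun v => funext fun x => ?_
  simp only [← mulVec_mulVec, siteHom_mulVec, Function.update_of_ne h, Function.update_of_ne h.symm,
    Finset.mul_sum]
  rw [Finset.sum_comm]
  refine Finset.sum_congr rfl fun s _ => Finset.sum_congr rfl fun t _ => ?_
  rw [Function.update_comm h]
  ring

/-- The single-site L-operator, as a `2 × 2` matrix of `2 × 2` matrices. -/
def localL (lam : ℂ) : Matrix (Fin 2) (Fin 2) (Matrix (Fin 2) (Fin 2) ℂ) :=
  !![!![lam + I / 2, 0; 0, lam - I / 2], !![0, 0; I, 0];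
    !![0, I; 0, 0], !![lam - I / 2, 0; 0, lam + I / 2]]

/-- The `k`-th L-operator as a `2 × 2` matrix of operators on `𝔥_N`. -/
def blockL (N : ℕ) (lam : ℂ) (k : Fin N) : Matrix (Fin 2) (Fin 2) (Matrix (St N) (St N) ℂ) :=
  (localL lam).map (siteHom N k)

theorem localL_apply (lam : ℂ) (i j : Fin 2) :
    localL lam i j = lam • (1 : Matrix (Fin 2) (Fin 2) (Matrix (Fin 2) (Fin 2) ℂ)) i j +
      (I / 2) • ∑ a, pauli a i j • pauli a := by
  ext s t
  fin_cases i <;> fin_cases j <;> fin_cases s <;> fin_cases t <;>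
    simp [localL, pauli, Fin.sum_univ_three] <;> ring_nf

theorem comp_blockL (N : ℕ) (lam : ℂ) (k : Fin N) :
    compRingEquiv (Fin 2) (St N) ℂ (blockL N lam k) = Lop N lam k := by
  have hsite (a : Fin 3) : siteHom N k (pauli a) = siteOp N a k := rfl
  ext ⟨i, x⟩ ⟨j, y⟩
  simp only [compRingEquiv_apply, comp_apply, blockL, map_apply, localL_apply, map_add, map_smul,
    map_sum, hsite, Lop, Matrix.add_apply, Matrix.smul_apply, Matrix.sum_apply, of_apply, smul_eq_mul]
  congr 2
  by_cases h : i = j <;> simp [h, one_apply]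

/-- The block form of the product of the L-operators over a list of sites. -/
def blockProd (N : ℕ) (lam : ℂ) (s : List (Fin N)) :
    Matrix (Fin 2) (Fin 2) (Matrix (St N) (St N) ℂ) :=
  (s.map (blockL N lam)).prod

theorem monodromy_apply (N : ℕ) (lam : ℂ) (i j : Fin 2) (x y : St N) :
    monodromy N lam (i, x) (j, y) = blockProd N lam (List.finRange N).reverse i j x y := by
  have h : compRingEquiv (Fin 2) (St N) ℂ (blockProd N lam (List.finRange N).reverse) =
      monodromy N lam := by
    rw [blockProd, map_list_prod, List.map_map, monodromy]
    congr 2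
    funext k
    exact comp_blockL N lam k
  rw [← h]
  rfl

/-- The component form of the RTT relation with the rational R-matrix of parameter `c`. -/
def RTT {R : Type*} [Ring R] [Algebra ℂ R] (c : ℂ) (X Y : Matrix (Fin 2) (Fin 2) R) : Prop :=
  ∀ i j k l, c • (X i j * Y k l - Y k l * X i j) = I • (Y k j * X i l - X k j * Y i l)

theorem RTT.mul {R : Type*} [Ring R] [Algebra ℂ R] {c : ℂ} {X Y X' Y' : Matrix (Fin 2) (Fin 2) R}
    (h : RTT c X Y) (h' : RTT c X' Y')
    (hXY : ∀ i j k l, Commute (X i j) (Y' k l)) (hYX : ∀ i j k l, Commute (Y i j) (X' k l)) :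
    RTT c (X * X') (Y * Y') := by
  intro i j k l
  have hswap {p q r s : R} (hqr : Commute q r) : p * q * (r * s) = p * r * (q * s) := by
    rw [mul_assoc, ← mul_assoc q, hqr.eq]; simp only [mul_assoc]
  have key (a b : Fin 2) :
      c • (X i a * X' a j * (Y k b * Y' b l) - Y k b * Y' b l * (X i a * X' a j)) =
        I • (Y k a * X i b * (X' a j * Y' b l) - X k a * X' a j * (Y i b * Y' b l)) +
        I • (Y k b * Y' b j * (X i a * X' a l) - Y k b * X i a * (X' b j * Y' a l)) := by
    rw [hswap (hYX k b a j).symm, hswap (hXY i a b l).symm,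
      hswap (hYX i b a j).symm, hswap (hXY i a b j).symm,
      show X i a * Y k b * (X' a j * Y' b l) - Y k b * X i a * (Y' b l * X' a j) =
        (X i a * Y k b - Y k b * X i a) * (X' a j * Y' b l) +
        Y k b * X i a * (X' a j * Y' b l - Y' b l * X' a j) by noncomm_ring,
      smul_add, ← smul_mul_assoc, ← mul_smul_comm, h i a k b, h' a j b l,
      smul_mul_assoc, mul_smul_comm, sub_mul, mul_sub]
  simp only [mul_apply, Fin.sum_univ_two]
  linear_combination (norm := (simp only [smul_sub, smul_add, mul_add, add_mul]; abel))
    key 0 0 + key 0 1 + key 1 0 + key 1 1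

theorem RTT.map {R S : Type*} [Ring R] [Algebra ℂ R] [Ring S] [Algebra ℂ S] {c : ℂ}
    {X Y : Matrix (Fin 2) (Fin 2) R} (h : RTT c X Y) (f : R →ₐ[ℂ] S) :
    RTT c (X.map f) (Y.map f) := fun i j k l => by
  simpa using congrArg f (h i j k l)

theorem RTT_one {R : Type*} [Ring R] [Algebra ℂ R] (c : ℂ) :
    RTT c (1 : Matrix (Fin 2) (Fin 2) R) 1 := fun i j k l => by
  by_cases h : i = j <;> by_cases h' : k = l <;> simp [one_apply, h, h']

theorem RTT_localL (lam mu : ℂ) : RTT (lam - mu) (localL lam) (localL mu) := by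
  intro i j k l
  fin_cases i <;> fin_cases j <;> fin_cases k <;> fin_cases l <;> ext s t <;>
    fin_cases s <;> fin_cases t <;> simp [localL] <;> ring_nf <;> simp <;> ring

theorem commute_blockL_blockProd {N : ℕ} (lam mu : ℂ) {k : Fin N} {s : List (Fin N)} (hk : k ∉ s)
    (i j i' j' : Fin 2) : Commute (blockL N lam k i j) (blockProd N mu s i' j') := by
  induction s generalizing i' j' with
  | nil =>
    by_cases h : i' = j' <;> simp [blockProd, h, one_apply]
  | cons m s ih =>
    rw [List.mem_cons, not_or] at hk
    simp only [blockProd, List.map_cons, List.prod_cons, mul_apply]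
    exact Commute.sum_right _ _ _ fun a _ =>
      (commute_siteHom hk.1 _ _).mul_right (ih hk.2 a j')

theorem RTT_blockProd {N : ℕ} (lam mu : ℂ) {s : List (Fin N)} (hs : s.Nodup) :
    RTT (lam - mu) (blockProd N lam s) (blockProd N mu s) := by
  induction s with
  | nil => exact RTT_one _
  | cons k s ih =>
    rw [List.nodup_cons] at hs
    simp only [blockProd, List.map_cons, List.prod_cons]
    exact ((RTT_localL lam mu).map (siteHom N k)).mul (ih hs.2)
      (commute_blockL_blockProd lam mu hs.1) (commute_blockL_blockProd mu lam hs.1)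

theorem siteHom_mulVec_vac {N : ℕ} (k : Fin N) {M : Matrix (Fin 2) (Fin 2) ℂ} (h : M 1 0 = 0) :
    siteHom N k M *ᵥ vac N = M 0 0 • vac N := by
  funext x
  have h1 : Function.update x k 1 ≠ fun _ => 0 := fun hx => by
    simpa using congrFun hx k
  rw [siteHom_mulVec, Fin.sum_univ_two]
  simp only [vac, if_neg h1, mul_zero, add_zero, Pi.smul_apply, smul_eq_mul]
  obtain hx | hx : x k = 0 ∨ x k = 1 := by omega
  · rw [← hx, Function.update_eq_self]
  · have hx0 : x ≠ fun _ => 0 := fun h0 => by simp [h0] at hx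
    simp [hx, h, hx0]

theorem blockProd_mulVec_vac {N : ℕ} (lam : ℂ) {s : List (Fin N)} (hs : s.Nodup) :
    blockProd N lam s 0 0 *ᵥ vac N = (lam + I / 2) ^ s.length • vac N ∧
    blockProd N lam s 1 0 *ᵥ vac N = 0 ∧
    blockProd N lam s 1 1 *ᵥ vac N = (lam - I / 2) ^ s.length • vac N := by
  induction s with
  | nil => simp [blockProd]
  | cons k s ih =>
    rw [List.nodup_cons] at hs
    obtain ⟨ih0, ih1, ih2⟩ := ih hs.2
    have h00 : blockL N lam k 0 0 *ᵥ vac N = (lam + I / 2) • vac N :=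
      siteHom_mulVec_vac k (by simp [localL])
    have h10 : blockL N lam k 1 0 *ᵥ vac N = 0 :=
      (siteHom_mulVec_vac k (by simp [localL])).trans (by simp [localL])
    have h11 : blockL N lam k 1 1 *ᵥ vac N = (lam - I / 2) • vac N :=
      siteHom_mulVec_vac k (by simp [localL])
    have hcons (i j : Fin 2) : blockProd N lam (k :: s) i j =
        blockL N lam k i 0 * blockProd N lam s 0 j +
          blockL N lam k i 1 * blockProd N lam s 1 j := by
      simp [blockProd, mul_apply]
    simp only [hcons, add_mulVec]
    rw [(commute_blockL_blockProd lam lam hs.1 1 0 0 1).eq]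
    simp only [← mulVec_mulVec, ih0, ih1, ih2, h00, h10, h11, mulVec_smul, mulVec_zero, smul_zero,
      add_zero, zero_add, smul_smul, List.length_cons, pow_succ, and_self]

theorem nodup_reverse_finRange (N : ℕ) : (List.finRange N).reverse.Nodup :=
  List.nodup_reverse.mpr (List.nodup_finRange N)

theorem Aop_eq (N : ℕ) (lam : ℂ) : Aop N lam = blockProd N lam (List.finRange N).reverse 0 0 := by
  ext; simp [Aop, monodromy_apply]

theorem Bop_eq (N : ℕ) (lam : ℂ) : Bop N lam = blockProd N lam (List.finRange N).reverse 0 1 := by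
  ext; simp [Bop, monodromy_apply]

theorem Dop_eq (N : ℕ) (lam : ℂ) : Dop N lam = blockProd N lam (List.finRange N).reverse 1 1 := by
  ext; simp [Dop, monodromy_apply]

theorem Aop_mulVec_vac (N : ℕ) (lam : ℂ) : Aop N lam *ᵥ vac N = (lam + I / 2) ^ N • vac N := by
  simpa [Aop_eq] using (blockProd_mulVec_vac lam (nodup_reverse_finRange N)).1

theorem Dop_mulVec_vac (N : ℕ) (lam : ℂ) : Dop N lam *ᵥ vac N = (lam - I / 2) ^ N • vac N := by
  simpa [Dop_eq] using (blockProd_mulVec_vac lam (nodup_reverse_finRange N)).2.2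

theorem commute_Bop (N : ℕ) (lam mu : ℂ) : Commute (Bop N lam) (Bop N mu) := by
  have hcomm (x y : ℂ) (h : x - y + I ≠ 0) : Commute (Bop N x) (Bop N y) := by
    have hr := RTT_blockProd x y (nodup_reverse_finRange N) 0 1 0 1
    rw [← Bop_eq, ← Bop_eq] at hr
    have h0 : (x - y + I) • (Bop N x * Bop N y - Bop N y * Bop N x) = 0 := by
      rw [add_smul, hr]; module
    exact sub_eq_zero.mp ((smul_eq_zero.mp h0).resolve_left h)
  by_cases h : lam - mu + I = 0
  · refine (hcomm mu lam fun h' => I_ne_zero ?_).symm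
    linear_combination (h + h') / 2
  · exact hcomm lam mu h

theorem Aop_mul_Bop (N : ℕ) {lam mu : ℂ} (h : lam ≠ mu) :
    Aop N lam * Bop N mu = (1 - I / (lam - mu)) • (Bop N mu * Aop N lam) +
      (I / (lam - mu)) • (Bop N lam * Aop N mu) := by
  have hr := RTT_blockProd mu lam (nodup_reverse_finRange N) 0 1 0 0
  rw [← Bop_eq, ← Aop_eq, ← Bop_eq, ← Aop_eq] at hr
  have hne : lam - mu ≠ 0 := sub_ne_zero.mpr h
  have h1 : Aop N lam * Bop N mu = Bop N mu * Aop N lam +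
      (lam - mu)⁻¹ • ((mu - lam) • (Bop N mu * Aop N lam - Aop N lam * Bop N mu)) := by
    rw [← neg_sub lam mu, smul_smul, mul_neg, inv_mul_cancel₀ hne]; module
  rw [h1, hr]
  module

theorem Dop_mul_Bop (N : ℕ) {lam mu : ℂ} (h : lam ≠ mu) :
    Dop N lam * Bop N mu = (1 - (-I) / (lam - mu)) • (Bop N mu * Dop N lam) +
      ((-I) / (lam - mu)) • (Bop N lam * Dop N mu) := by
  have hr := RTT_blockProd lam mu (nodup_reverse_finRange N) 1 1 0 1
  rw [← Bop_eq, ← Dop_eq, ← Bop_eq, ← Dop_eq] at hr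
  have hne : lam - mu ≠ 0 := sub_ne_zero.mpr h
  have h1 : Dop N lam * Bop N mu = Bop N mu * Dop N lam +
      (lam - mu)⁻¹ • ((lam - mu) • (Dop N lam * Bop N mu - Bop N mu * Dop N lam)) := by
    rw [smul_smul, inv_mul_cancel₀ hne]; module
  rw [h1, hr]
  module

/-- Moving an operator `X` through a product of commuting creation operators `B`, given the
exchange relation between `X` and `B` and an eigenvector `v` of `X`. -/
theorem mulVec_prod_of_exchange {n : Type*} [Fintype n] [DecidableEq n] (c : ℂ)
    {X B : ℂ → Matrix n n ℂ} {x : ℂ → ℂ} {v : n → ℂ} (hB : ∀ z w, Commute (B z) (B w))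
    (hXB : ∀ z w, z ≠ w → X z * B w =
      (1 - c / (z - w)) • (B w * X z) + (c / (z - w)) • (B z * X w))
    (hv : ∀ z, X z *ᵥ v = x z • v) {l : ℕ} (z : ℂ) (w : Fin l → ℂ)
    (hw : Function.Injective w) (hz : ∀ j, z ≠ w j) :
    X z *ᵥ (((List.finRange l).map fun j => B (w j)).prod *ᵥ v) =
      (x z * ∏ j, (1 - c / (z - w j))) • (((List.finRange l).map fun j => B (w j)).prod *ᵥ v) +
        ∑ k, (c / (z - w k) * x (w k) * ∏ j ∈ Finset.univ.erase k, (1 - c / (w k - w j))) •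
          ((B z * (((List.finRange l).filter fun j => j ≠ k).map fun j => B (w j)).prod) *ᵥ v) := by
  induction l generalizing z with
  | zero => simp [hv]
  | succ l ih =>
    have hw' : Function.Injective fun j : Fin l => w j.succ :=
      hw.comp (Fin.succ_injective l)
    have hne (j : Fin l) : w 0 ≠ w j.succ := fun h => Fin.succ_ne_zero j (hw h).symm
    have ihz := ih z (fun j => w j.succ) hw' fun j => hz j.succ
    have ih0 := ih (w 0) (fun j => w j.succ) hw' hne
    have hfilter0 : (List.finRange (l + 1)).filter (fun j => j ≠ 0) =
        (List.finRange l).map Fin.succ := by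
      simp [List.finRange_succ, List.filter_map, Function.comp_def]
    have hfilter (k : Fin l) : (List.finRange (l + 1)).filter (fun j => j ≠ k.succ) =
        0 :: ((List.finRange l).filter fun j => j ≠ k).map Fin.succ := by
      simp [List.finRange_succ, List.filter_map, Function.comp_def, (Fin.succ_ne_zero k).symm]
    have herase0 (f : Fin (l + 1) → ℂ) :
        ∏ j ∈ Finset.univ.erase 0, f j = ∏ j : Fin l, f j.succ := by
      simp [← Finset.filter_ne', Finset.prod_filter, Fin.prod_univ_succ]
    have herase (k : Fin l) (f : Fin (l + 1) → ℂ) :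
        ∏ j ∈ Finset.univ.erase k.succ, f j = f 0 * ∏ j ∈ Finset.univ.erase k, f j.succ := by
      simp [← Finset.filter_ne', Finset.prod_filter, Fin.prod_univ_succ, (Fin.succ_ne_zero k).symm]
    simp only [Fin.sum_univ_succ, Fin.prod_univ_succ, hfilter0, hfilter, herase0, herase]
    simp only [List.finRange_succ, List.map_cons, List.prod_cons, List.map_map, Function.comp_def]
    simp only [← mulVec_mulVec] at ihz ih0 ⊢
    rw [mulVec_mulVec _ (X z), hXB z (w 0) (hz 0), add_mulVec, smul_mulVec, smul_mulVec,
      ← mulVec_mulVec, ← mulVec_mulVec, ihz, ih0]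
    simp only [mulVec_add, mulVec_smul, mulVec_sum, smul_add, Finset.smul_sum, smul_smul]
    rw [add_add_add_comm, ← Finset.sum_add_distrib, add_assoc]
    refine congrArg₂ _ (by ring_nf) (congrArg₂ _ (by ring_nf) (Finset.sum_congr rfl fun k _ => ?_))
    rw [mulVec_mulVec _ (B (w 0)), (hB (w 0) z).eq, ← mulVec_mulVec, ← add_smul]
    congr 1
    have h1 : z - w 0 ≠ 0 := sub_ne_zero.mpr (hz 0)
    have h2 : z - w k.succ ≠ 0 := sub_ne_zero.mpr (hz _)
    have h3 : w 0 - w k.succ ≠ 0 := sub_ne_zero.mpr (hne k)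
    have h4 : w k.succ - w 0 ≠ 0 := sub_ne_zero.mpr (hne k).symm
    have hcoef : (1 - c / (z - w 0)) * (c / (z - w k.succ)) +
        c / (z - w 0) * (c / (w 0 - w k.succ)) =
          c / (z - w k.succ) * (1 - c / (w k.succ - w 0)) := by
      field_simp
      ring
    linear_combination (x (w k.succ) *
      ∏ j ∈ Finset.univ.erase k, (1 - c / (w k.succ - w j.succ))) * hcoef

theorem sub_sub_div_sub (c : ℂ) {z w : ℂ} (h : z ≠ w) : (z - w - c) / (z - w) = 1 - c / (z - w) := by
  rw [sub_div, div_self (sub_ne_zero.mpr h)]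

theorem sub_sub_div_sub_comm (c : ℂ) {z w : ℂ} (h : z ≠ w) :
    (w - z - c) / (w - z) = 1 - (-c) / (z - w) := by
  rw [sub_sub_div_sub c h.symm, ← neg_sub z w, div_neg, neg_div]

/-- Action of the transfer matrix on a Bethe vector: the wanted term plus
the unwanted terms. -/
theorem transfer_matrix_on_bethe_vector (N : ℕ) (hN : 1 ≤ N) {l : ℕ}
    (lam0 : ℂ) (lam : Fin l → ℂ)
    (hinj : Function.Injective lam) (h0 : ∀ j, lam0 ≠ lam j) :
    (Aop N lam0 + Dop N lam0).mulVec (betheVec N lam) =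
      Lam N lam0 lam • betheVec N lam +
        ∑ k : Fin l, LamK N lam0 lam k •
          (Bop N lam0 *
            (((List.finRange l).filter fun j => j ≠ k).map fun j =>
              Bop N (lam j)).prod).mulVec (vac N) := by
  have hA := mulVec_prod_of_exchange I (commute_Bop N) (fun _ _ => Aop_mul_Bop N)
    (Aop_mulVec_vac N) lam0 lam hinj h0
  have hD := mulVec_prod_of_exchange (-I) (commute_Bop N) (fun _ _ => Dop_mul_Bop N)
    (Dop_mulVec_vac N) lam0 lam hinj h0
  have hk (k : Fin l) {j : Fin l} (hj : j ∈ Finset.univ.erase k) : lam k ≠ lam j :=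
    fun h => Finset.ne_of_mem_erase hj (hinj h).symm
  rw [add_mulVec, betheVec, betheProd, hA, hD, add_add_add_comm, ← add_smul,
    ← Finset.sum_add_distrib, Lam,
    Finset.prod_congr rfl fun j _ => sub_sub_div_sub I (h0 j),
    Finset.prod_congr rfl fun j _ => sub_sub_div_sub_comm I (h0 j)]
  congr 1
  refine Finset.sum_congr rfl fun k _ => ?_
  rw [← add_smul, LamK, Finset.prod_congr rfl fun j hj => sub_sub_div_sub I (hk k hj),
    Finset.prod_congr rfl fun j hj => sub_sub_div_sub_comm I (hk k hj)]
  congr 1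
  ring
end
end

section
/- For every N ≥ 1, the operator product vanishes identically: B_N(i/2) · B_N(−i/2) = 0 as an operator on 𝔥_N. -/
open Complex Matrix Filter Topology

noncomputable section

/-- The matrix of an operator acting as the identity on every site other than `k`
factors through the local entries at site `k`. -/
theorem Lop_apply (N : ℕ) (lam : ℂ) (k : Fin N) (a b : Fin 2) (x y : St N) :
    Lop N lam k (a, x) (b, y) =
      (lam * ((if a = b then 1 else 0) * (if x k = y k then 1 else 0)) +
        Complex.I / 2 * ∑ c : Fin 3, pauli c a b * pauli c (x k) (y k)) *
      ∏ j ∈ Finset.univ.erase k, (if x j = y j then (1 : ℂ) else 0) := by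
  have h_one : (1 : Matrix (Fin 2 × St N) (Fin 2 × St N) ℂ) (a, x) (b, y) =
      ((if a = b then 1 else 0) * (if x k = y k then 1 else 0)) *
        ∏ j ∈ Finset.univ.erase k, (if x j = y j then (1 : ℂ) else 0) := by
    rw [mul_assoc, Finset.mul_prod_erase Finset.univ
      (fun j => if x j = y j then (1 : ℂ) else 0) (Finset.mem_univ k), Fintype.prod_ite_zero]
    simp only [Matrix.one_apply, Prod.ext_iff, funext_iff, ite_and, Finset.prod_const_one,
      ite_mul, one_mul, zero_mul]
  rw [Lop, Matrix.add_apply, Matrix.smul_apply, Matrix.smul_apply, h_one, Matrix.sum_apply]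
  simp only [siteOp, Matrix.of_apply, smul_eq_mul, add_mul, Finset.sum_mul, Finset.mul_sum,
    mul_assoc]

theorem Lop_apply_eq_zero_of_ne {N : ℕ} (lam : ℂ) {k j : Fin N} (hjk : j ≠ k)
    {p q : Fin 2 × St N} (h : p.2 j ≠ q.2 j) : Lop N lam k p q = 0 := by
  rw [← p.eta, ← q.eta, Lop_apply, Finset.prod_eq_zero (i := j) (by simp [hjk]) (if_neg h),
    mul_zero]

/-- A product of L-operators at sites other than `j` is diagonal at site `j`. -/
theorem prod_map_Lop_apply_eq_zero_of_ne {N : ℕ} (lam : ℂ) {j : Fin N} (l : List (Fin N))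
    (hl : j ∉ l) {p q : Fin 2 × St N} (h : p.2 j ≠ q.2 j) :
    (l.map (Lop N lam)).prod p q = 0 := by
  induction l generalizing p with
  | nil =>
    rw [List.map_nil, List.prod_nil, Matrix.one_apply_ne]
    rintro rfl
    exact h rfl
  | cons k l ih =>
    rw [List.mem_cons, not_or] at hl
    rw [List.map_cons, List.prod_cons, Matrix.mul_apply]
    refine Finset.sum_eq_zero fun r _ => ?_
    by_cases hr : p.2 j = r.2 j
    · rw [ih hl.2 (hr ▸ h), mul_zero]
    · rw [Lop_apply_eq_zero_of_ne lam hl.1 hr, zero_mul]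

/-- `L(i/2)` is a multiple of the permutation operator, so it moves the output auxiliary
state to the site. -/
theorem Lop_half_I_apply_eq_zero {N : ℕ} (k : Fin N) (x : St N) (q : Fin 2 × St N)
    (h : q.2 k ≠ 0) : Lop N (Complex.I / 2) k (0, x) q = 0 := by
  obtain ⟨b, y⟩ := q
  have hy : y k = 1 := Fin.eq_one_of_ne_zero _ h
  rw [Lop_apply, hy]
  refine mul_eq_zero_of_left ?_ _
  generalize x k = c
  fin_cases b <;> fin_cases c <;> simp [pauli, Fin.sum_univ_three]

/-- `L(-i/2)` is a multiple of the antisymmetrizer. -/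
theorem Lop_neg_half_I_apply_eq_zero {N : ℕ} (k : Fin N) (x : St N) (q : Fin 2 × St N)
    (h : x k = 0) : Lop N (-(Complex.I / 2)) k (0, x) q = 0 := by
  obtain ⟨b, y⟩ := q
  rw [Lop_apply, h]
  refine mul_eq_zero_of_left ?_ _
  generalize y k = c
  fin_cases b <;> fin_cases c <;> simp [pauli, Fin.sum_univ_three]

theorem monodromy_succ (M : ℕ) (lam : ℂ) :
    monodromy (M + 1) lam = Lop (M + 1) lam (Fin.last M) *
      ((((List.finRange M).map Fin.castSucc).reverse).map (Lop (M + 1) lam)).prod := by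
  simp [monodromy, List.finRange_succ_last]

theorem Bop_half_I_apply_eq_zero {M : ℕ} (x y : St (M + 1)) (h : y (Fin.last M) ≠ 0) :
    Bop (M + 1) (Complex.I / 2) x y = 0 := by
  rw [Bop, Matrix.of_apply, monodromy_succ, Matrix.mul_apply]
  refine Finset.sum_eq_zero fun q _ => ?_
  by_cases hq : q.2 (Fin.last M) = 0
  · rw [prod_map_Lop_apply_eq_zero_of_ne (j := Fin.last M) _ _
      (by simp [Fin.castSucc_ne_last]) (by rw [hq]; exact h.symm), mul_zero]
  · rw [Lop_half_I_apply_eq_zero _ _ _ hq, zero_mul]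

theorem Bop_neg_half_I_apply_eq_zero {M : ℕ} (x y : St (M + 1)) (h : x (Fin.last M) = 0) :
    Bop (M + 1) (-(Complex.I / 2)) x y = 0 := by
  rw [Bop, Matrix.of_apply, monodromy_succ, Matrix.mul_apply]
  refine Finset.sum_eq_zero fun q _ => ?_
  rw [Lop_neg_half_I_apply_eq_zero _ _ _ h, zero_mul]

/-- The operator product `B_N(i/2) B_N(−i/2)` vanishes identically. -/
theorem B_product_at_singular_points_vanishes (N : ℕ) (hN : 1 ≤ N) :
    Bop N (Complex.I / 2) * Bop N (-(Complex.I / 2)) = 0 := by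
  obtain ⟨M, rfl⟩ := Nat.exists_eq_add_of_le' hN
  ext x y
  rw [Matrix.mul_apply, Matrix.zero_apply]
  refine Finset.sum_eq_zero fun z _ => ?_
  by_cases hz : z (Fin.last M) = 0
  · rw [Bop_neg_half_I_apply_eq_zero _ _ hz, mul_zero]
  · rw [Bop_half_I_apply_eq_zero _ _ hz, zero_mul]
end
end

section
/- Let N ≥ 2 and let λ₃, …, λ_ℓ ∈ ℂ be pairwise distinct with λ_j ≠ i/2 and λ_j ≠ −i/2 for all j, and set c = −(2/i^{N+1}) ∏_{j=3}^{ℓ} (λ_j − 3i/2)/(λ_j + i/2). Then for every fixed λ ∈ ℂ with λ ≠ i/2, λ ≠ −i/2 and λ ∉ {λ₃,…,λ_ℓ}, the function ε ↦ Λ₁(λ; λ₁(ε), λ₂(ε), λ₃, …, λ_ℓ) is O(ε^{N+1}) as ε → 0; in particular lim_{ε→0} ε^{−N} Λ₁(λ; λ₁(ε), λ₂(ε), λ₃, …, λ_ℓ) = 0. -/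
open Complex Matrix Filter Topology

noncomputable section

theorem prod_univ_erase_zero {M : Type*} [CommMonoid M] {n : ℕ} (f : Fin (n + 1) → M) :
    ∏ j ∈ Finset.univ.erase 0, f j = ∏ j : Fin n, f j.succ := by
  rw [Fin.univ_succ, Finset.erase_cons, Finset.prod_map]
  rfl

/-- The quotient `Λ₁(λ; λ₁(ε), λ₂(ε), λ₃,…,λ_ℓ) / ε^N`, with the factor `ε^N` cancelled. -/
def LamOneQuotient (N : ℕ) (c : ℂ) {m : ℕ} (mu : Fin m → ℂ) (lam0 eps : ℂ) : ℂ :=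
  Complex.I / (lam0 - nwLam1 N c eps) *
    ((nwLam1 N c eps + Complex.I / 2) ^ N *
        (c / (Complex.I + c * eps ^ N) *
          ∏ j, (nwLam1 N c eps - mu j - Complex.I) / (nwLam1 N c eps - mu j)) -
      (1 + c * eps ^ (N - 1)) ^ N *
        ((2 * Complex.I + c * eps ^ N) / (Complex.I + c * eps ^ N) *
          ∏ j, (mu j - nwLam1 N c eps - Complex.I) / (mu j - nwLam1 N c eps)))

theorem LamK_nwTuple_zero (N : ℕ) (hN : N ≠ 0) (c : ℂ) {m : ℕ} (mu : Fin m → ℂ)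
    (lam0 eps : ℂ) :
    LamK N lam0 (nwTuple N c mu eps) 0 = eps ^ N * LamOneQuotient N c mu lam0 eps := by
  obtain ⟨n, rfl⟩ := Nat.exists_eq_succ_of_ne_zero hN
  have h12 : nwLam1 (n + 1) c eps - nwLam2 eps = Complex.I + c * eps ^ (n + 1) := by
    rw [nwLam1, nwLam2]; ring
  have h12' : nwLam1 (n + 1) c eps - nwLam2 eps - Complex.I = c * eps ^ (n + 1) := by
    rw [h12]; ring
  have h21 : (nwLam2 eps - nwLam1 (n + 1) c eps - Complex.I) /
      (nwLam2 eps - nwLam1 (n + 1) c eps) =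
      (2 * Complex.I + c * eps ^ (n + 1)) / (Complex.I + c * eps ^ (n + 1)) := by
    rw [← neg_div_neg_eq, neg_sub (nwLam2 eps), h12]
    congr 1
    linear_combination h12
  have h1 : nwLam1 (n + 1) c eps - Complex.I / 2 = eps * (1 + c * eps ^ n) := by
    rw [nwLam1]; ring
  simp only [LamK, LamOneQuotient, prod_univ_erase_zero, Fin.prod_univ_succ (n := m), nwTuple,
    Fin.cons_zero, Fin.cons_succ, Nat.succ_eq_add_one, Nat.add_sub_cancel]
  rw [h12', h12, h21, h1, mul_pow]
  ring

theorem LamOneQuotient_zero (N : ℕ) (hN : 2 ≤ N) {m : ℕ} (mu : Fin m → ℂ)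
    (hm : ∀ j, mu j ≠ -(Complex.I / 2)) (c : ℂ)
    (hc : c = -(2 / Complex.I ^ (N + 1)) *
      ∏ j, (mu j - 3 * Complex.I / 2) / (mu j + Complex.I / 2))
    (lam0 : ℂ) :
    LamOneQuotient N c mu lam0 0 = 0 := by
  have hI := Complex.I_ne_zero
  have h1 : nwLam1 N c 0 = Complex.I / 2 := by
    simp [nwLam1, show N ≠ 0 by lia]
  have hprod : (∏ j, (mu j - 3 * Complex.I / 2) / (mu j + Complex.I / 2)) *
      ∏ j, (Complex.I / 2 - mu j - Complex.I) / (Complex.I / 2 - mu j) =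
      ∏ j, (mu j - Complex.I / 2 - Complex.I) / (mu j - Complex.I / 2) := by
    rw [← Finset.prod_mul_distrib]
    refine Finset.prod_congr rfl fun j _ => ?_
    have hj : mu j + Complex.I / 2 ≠ 0 := fun h => hm j (eq_neg_of_add_eq_zero_left h)
    rw [← neg_div_neg_eq (Complex.I / 2 - mu j - Complex.I), neg_sub (Complex.I / 2),
      show -(Complex.I / 2 - mu j - Complex.I) = mu j + Complex.I / 2 by ring,
      div_mul_div_cancel₀ hj]
    congr 1
    ring
  have hIc : Complex.I ^ N * (c / Complex.I) =
      2 * ∏ j, (mu j - 3 * Complex.I / 2) / (mu j + Complex.I / 2) := by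
    rw [hc, pow_succ]
    field_simp
    simp
  simp only [LamOneQuotient, h1, zero_pow (show N ≠ 0 by lia), zero_pow (show N - 1 ≠ 0 by lia),
    mul_zero, add_zero, one_pow, one_mul, add_halves, mul_div_cancel_right₀ _ hI]
  rw [← mul_assoc (Complex.I ^ N), hIc, mul_assoc, hprod, sub_self, mul_zero]

theorem differentiableAt_LamOneQuotient (N : ℕ) (hN : N ≠ 0) {m : ℕ} (mu : Fin m → ℂ)
    (hp : ∀ j, mu j ≠ Complex.I / 2) (c lam0 : ℂ) (h0p : lam0 ≠ Complex.I / 2) :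
    DifferentiableAt ℂ (LamOneQuotient N c mu lam0) 0 := by
  have h1 : nwLam1 N c 0 = Complex.I / 2 := by simp [nwLam1, hN]
  have hd : DifferentiableAt ℂ (nwLam1 N c) 0 := by unfold nwLam1; fun_prop
  have hI : Complex.I + c * (0 : ℂ) ^ N ≠ 0 := by simp [hN]
  have hl : lam0 - nwLam1 N c 0 ≠ 0 := by rw [h1]; exact sub_ne_zero.2 h0p
  have hA : DifferentiableAt ℂ (fun eps =>
      ∏ j, (nwLam1 N c eps - mu j - Complex.I) / (nwLam1 N c eps - mu j)) 0 :=
    DifferentiableAt.fun_finsetProd fun j _ =>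
      DifferentiableAt.fun_div (by fun_prop) (by fun_prop)
        (by rw [h1]; exact sub_ne_zero.2 (hp j).symm)
  have hB : DifferentiableAt ℂ (fun eps =>
      ∏ j, (mu j - nwLam1 N c eps - Complex.I) / (mu j - nwLam1 N c eps)) 0 :=
    DifferentiableAt.fun_finsetProd fun j _ =>
      DifferentiableAt.fun_div (by fun_prop) (by fun_prop)
        (by rw [h1]; exact sub_ne_zero.2 (hp j))
  unfold LamOneQuotient
  fun_prop (disch := assumption)

/-- With `c = −(2/i^{N+1}) ∏ⱼ (λⱼ − 3i/2)/(λⱼ + i/2)`, the coefficient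
`Λ₁(λ; λ₁(ε), λ₂(ε), λ₃,…,λ_ℓ)` is `O(ε^{N+1})` as `ε → 0`; in particular
`ε^{−N} Λ₁ → 0`. -/
theorem LamOne_asymptotics (N : ℕ) (hN : 2 ≤ N) {m : ℕ} (mu : Fin m → ℂ)
    (hinj : Function.Injective mu)
    (hp : ∀ j, mu j ≠ Complex.I / 2) (hm : ∀ j, mu j ≠ -(Complex.I / 2))
    (c : ℂ)
    (hc : c = -(2 / Complex.I ^ (N + 1)) *
      ∏ j, (mu j - 3 * Complex.I / 2) / (mu j + Complex.I / 2))
    (lam0 : ℂ) (h0p : lam0 ≠ Complex.I / 2) (h0m : lam0 ≠ -(Complex.I / 2))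
    (h0 : ∀ j, lam0 ≠ mu j) :
    Asymptotics.IsBigO (𝓝[≠] (0 : ℂ))
      (fun eps => LamK N lam0 (nwTuple N c mu eps) 0)
      (fun eps => eps ^ (N + 1)) ∧
    Tendsto (fun eps : ℂ => LamK N lam0 (nwTuple N c mu eps) 0 / eps ^ N)
      (𝓝[≠] (0 : ℂ)) (𝓝 0) := by
  have hN0 : N ≠ 0 := by lia
  have hd := differentiableAt_LamOneQuotient N hN0 mu hp c lam0 h0p
  have hz := LamOneQuotient_zero N hN mu hm c hc lam0
  have hO : Asymptotics.IsBigO (𝓝[≠] (0 : ℂ)) (LamOneQuotient N c mu lam0) (fun eps => eps) := by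
    simpa [hz] using hd.isBigO_sub.mono nhdsWithin_le_nhds
  simp only [LamK_nwTuple_zero N hN0]
  refine ⟨?_, ?_⟩
  · simpa only [pow_succ] using (Asymptotics.isBigO_refl (fun eps : ℂ => eps ^ N) _).mul hO
  · have ht : Tendsto (LamOneQuotient N c mu lam0) (𝓝[≠] 0) (𝓝 0) := by
      simpa only [hz] using hd.continuousAt.tendsto.mono_left nhdsWithin_le_nhds
    refine ht.congr' ?_
    filter_upwards [self_mem_nhdsWithin] with eps heps
    exact (mul_div_cancel_left₀ _ (pow_ne_zero N heps)).symm
end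
end
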